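/- Let Σ be an alphabet of size k and let A and B be partial DFAs over Σ with m states and n states respectively, both accepting finite languages. Then the concatenation L(A)·L(B) is accepted by a partial DFA with at most Σ_{i=0}^{m−1} min{ k^i, Σ_{j=0}^{f(A,i)} C(n−1, j) } + Σ_{j=0}^{f(A)} C(n−1, j) − 1 states, where C(·,·) denotes the binomial coefficient. -/

import Mathlib

open scoped Computability
open scoped Classical

/-- A partial DFA over alphabet `α` with state set `Fin n`. -/
structure PDFA (α : Type) (n : ℕ) where
  step : Fin n → α → Option (Fin n)
  start : Fin n
  accept : Finset (Fin n)

namespace PDFA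

variable {α : Type} {n : ℕ}

/-- Run the partial DFA from a state along a word; `none` if a transition is undefined. -/
def evalFrom (M : PDFA α n) : Fin n → List α → Option (Fin n)
  | q, [] => some q
  | q, a :: w => (M.step q a).bind fun q' => M.evalFrom q' w

/-- The language accepted by a partial DFA. -/
def lang (M : PDFA α n) : Language α :=
  {w | ∃ q ∈ M.accept, M.evalFrom M.start w = some q}

/-- The number of defined transitions. -/
noncomputable def transCount [Fintype α] (M : PDFA α n) : ℕ :=
  (Finset.univ.filter fun p : Fin n × α => (M.step p.1 p.2).isSome).card

/-- The number of defined `τ`-transitions. -/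
noncomputable def transCountOn (M : PDFA α n) (τ : α) : ℕ :=
  (Finset.univ.filter fun q : Fin n => (M.step q τ).isSome).card

/-- `s_τ`: 1 if a `τ`-transition is defined at the initial state, else 0. -/
def sOn (M : PDFA α n) (τ : α) : ℕ := if (M.step M.start τ).isSome then 1 else 0

/-- `s`: total over the alphabet of `s_τ`. -/
noncomputable def sTot [Fintype α] (M : PDFA α n) : ℕ := ∑ τ : α, M.sOn τ

/-- `s̄_τ = 1 - s_τ`. -/
def sbarOn (M : PDFA α n) (τ : α) : ℕ := 1 - M.sOn τ

/-- `a_τ`: the number of defined `τ`-transitions entering a final state. -/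
noncomputable def aOn (M : PDFA α n) (τ : α) : ℕ :=
  (Finset.univ.filter fun p : Fin n => ∃ q ∈ M.accept, M.step p τ = some q).card

/-- `e_τ`: the number of final states at which a `τ`-transition is defined. -/
noncomputable def eOn (M : PDFA α n) (τ : α) : ℕ :=
  (M.accept.filter fun q => (M.step q τ).isSome).card

/-- `ē_τ`: the number of final states at which no `τ`-transition is defined. -/
noncomputable def ebarOn (M : PDFA α n) (τ : α) : ℕ :=
  (M.accept.filter fun q => M.step q τ = none).card

/-- `t̄_τ`: the number of states at which no `τ`-transition is defined. -/
noncomputable def tbarOn (M : PDFA α n) (τ : α) : ℕ :=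
  (Finset.univ.filter fun q : Fin n => M.step q τ = none).card

/-- `f(A)`: the number of final states. -/
def fTot (M : PDFA α n) : ℕ := M.accept.card

/-- `f(A, i)`: the number of final states numbered strictly less than `i`. -/
noncomputable def fBelow (M : PDFA α n) (i : ℕ) : ℕ :=
  (M.accept.filter fun q => (q : ℕ) < i).card

/-- `t̄_τ(L, i)`: 1 if no `τ`-transition is defined at state `i`, else 0. -/
noncomputable def tbarAt (M : PDFA α n) (τ : α) (i : ℕ) : ℕ :=
  if h : i < n then (if M.step ⟨i, h⟩ τ = none then 1 else 0) else 0

/-- The states (numbered by `Fin n`) are topologically ordered: the initial state is `0`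
and every defined transition goes from a smaller-numbered to a larger-numbered state. -/
def Ordered (M : PDFA α n) : Prop :=
  (M.start : ℕ) = 0 ∧ ∀ q a q', M.step q a = some q' → q < q'

end PDFA

/-- The incomplete state complexity: the minimal number of states of a partial DFA
accepting `L`. -/
noncomputable def isc {α : Type} (L : Language α) : ℕ :=
  sInf {m | ∃ M : PDFA α m, M.lang = L}

/-- The incomplete transition complexity: the minimal number of defined transitions
over all partial DFAs accepting `L`. -/
noncomputable def itc {α : Type} [Fintype α] (L : Language α) : ℕ :=
  sInf {t | ∃ m, ∃ M : PDFA α m, M.lang = L ∧ M.transCount = t}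

/-- The minimal number of defined `τ`-transitions over all partial DFAs accepting `L`. -/
noncomputable def itcOn {α : Type} (L : Language α) (τ : α) : ℕ :=
  sInf {t | ∃ m, ∃ M : PDFA α m, M.lang = L ∧ M.transCountOn τ = t}


namespace PDFA

variable {α : Type} {m n : ℕ}

theorem evalFrom_append (M : PDFA α n) (q : Fin n) (u v : List α) :
    M.evalFrom q (u ++ v) = (M.evalFrom q u).bind fun p => M.evalFrom p v := by
  induction u generalizing q with
  | nil => rfl
  | cons a u ih =>
    simp only [List.cons_append, evalFrom]
    cases M.step q a with
    | none => rfl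
    | some p => exact ih p

theorem evalFrom_singleton (M : PDFA α n) (q : Fin n) (a : α) :
    M.evalFrom q [a] = M.step q a := by
  simp [evalFrom]

theorem evalFrom_concat (M : PDFA α n) (q : Fin n) (w : List α) (a : α) :
    M.evalFrom q (w ++ [a]) = (M.evalFrom q w).bind fun p => M.step p a := by
  simp [evalFrom_append, evalFrom_singleton]

theorem mem_lang (M : PDFA α n) (w : List α) :
    w ∈ M.lang ↔ ∃ q ∈ M.accept, M.evalFrom M.start w = some q :=
  Iff.rfl

theorem Ordered.add_length_le {M : PDFA α n} (hM : M.Ordered) {q p : Fin n} {w : List α}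
    (h : M.evalFrom q w = some p) : (q : ℕ) + w.length ≤ p := by
  induction w generalizing q with
  | nil =>
    simp only [evalFrom, Option.some.injEq] at h
    simp [h]
  | cons a w ih =>
    simp only [evalFrom, Option.bind_eq_some_iff] at h
    obtain ⟨r, hr, h⟩ := h
    have h₁ : (q : ℕ) < r := hM.2 q a r hr
    have h₂ := ih h
    simp only [List.length_cons]
    omega

/-- If some word is accepted and the language is finite, then no nonempty word leads back
to the initial state. -/
theorem eq_nil_of_evalFrom_start {M : PDFA α n} (hfin : Set.Finite {w : List α | w ∈ M.lang})
    {u : List α} (hu : u ∈ M.lang) {w : List α} (hw : M.evalFrom M.start w = some M.start) :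
    w = [] := by
  by_contra hne
  have hrep (j : ℕ) : M.evalFrom M.start (List.replicate j w).flatten = some M.start := by
    induction j with
    | zero => rfl
    | succ j ih => simp [List.replicate_succ, evalFrom_append, hw, ih]
  refine Set.infinite_of_injective_forall_mem
    (f := fun j : ℕ => (List.replicate j w).flatten ++ u) ?_ ?_ hfin
  · intro i j hij
    have h := congrArg List.length hij
    simpa [hne] using h
  · intro j
    obtain ⟨q, hq, huq⟩ := hu
    exact ⟨q, hq, by simp [evalFrom_append, hrep, huq]⟩

/-- A right-invariant map `r` on words with finitely many values that decides membership in `L`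
gives a partial DFA for `L` on the values of `r` other than a rejecting sink `d`. -/
theorem exists_lang_eq_of_rightInvariant {X : Type} (L : Language α) (r : List α → X) (d : X)
    (acc : X → Prop) (T : Finset X) (hT : ∀ x, x ∈ T ↔ x ≠ d ∧ ∃ w, r w = x)
    (hnil : r [] ≠ d)
    (hstep : ∀ w w' a, r w = r w' → r (w ++ [a]) = r (w' ++ [a]))
    (hd : ∀ w a, r w = d → r (w ++ [a]) = d)
    (hacc : ∀ w, w ∈ L ↔ acc (r w)) (hdacc : ¬ acc d) :
    ∃ C : PDFA α T.card, C.lang = L := by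
  have hsink (w v : List α) (h : r w = d) : r (w ++ v) = d := by
    induction v generalizing w with
    | nil => simpa using h
    | cons a v ih => simpa using ih (w ++ [a]) (hd w a h)
  have hmem (w : List α) (h : r w ≠ d) : r w ∈ T := (hT _).2 ⟨h, w, rfl⟩
  let e := T.equivFin
  have hword (q : Fin T.card) : ∃ w, r w = (e.symm q : X) := ((hT _).1 (e.symm q).2).2
  choose word h_word using hword
  let C : PDFA α T.card :=
    { step := fun q a =>
        if h : r (word q ++ [a]) ≠ d then some (e ⟨_, hmem _ h⟩) else none
      start := e ⟨_, hmem _ hnil⟩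
      accept := Finset.univ.filter fun q => acc (e.symm q) }
  have heval (v w : List α) (h : r w ≠ d) :
      C.evalFrom (e ⟨_, hmem _ h⟩) v =
        if h' : r (w ++ v) ≠ d then some (e ⟨_, hmem _ h'⟩) else none := by
    induction v generalizing w with
    | nil => simp [evalFrom, h]
    | cons a v ih =>
      have hr : r (word (e ⟨_, hmem _ h⟩) ++ [a]) = r (w ++ [a]) :=
        hstep _ _ _ (by simp [h_word])
      by_cases h₁ : r (w ++ [a]) = d
      · have h₂ : r (w ++ a :: v) = d := by simpa using hsink _ v h₁
        simp [evalFrom, C, hr, h₁, h₂]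
      · have := ih (w ++ [a]) h₁
        simp only [List.append_assoc, List.singleton_append] at this
        simp [evalFrom, C, hr, h₁] at this ⊢
        exact this
  refine ⟨C, ?_⟩
  ext w
  rw [mem_lang, hacc]
  have h := heval w [] hnil
  simp only [List.nil_append] at h
  change (∃ q ∈ C.accept, C.evalFrom (e ⟨_, hmem _ hnil⟩) w = some q) ↔ _
  rw [h]
  by_cases hw : r w = d
  · simp [hw, hdacc]
  · simp [hw, C]

/-- The states of `B` reached along a suffix of `w` whose complementary prefix is accepted
by `A`. -/
noncomputable def suffixStates (A : PDFA α m) (B : PDFA α n) (w : List α) : Finset (Fin n) :=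
  Finset.univ.filter fun p =>
    ∃ u v, u ++ v = w ∧ u ∈ A.lang ∧ B.evalFrom B.start v = some p

theorem mem_suffixStates {A : PDFA α m} {B : PDFA α n} {w : List α} {p : Fin n} :
    p ∈ suffixStates A B w ↔
      ∃ u v, u ++ v = w ∧ u ∈ A.lang ∧ B.evalFrom B.start v = some p := by
  simp [suffixStates]

theorem mem_suffixStates_nil {A : PDFA α m} {B : PDFA α n} {p : Fin n} :
    p ∈ suffixStates A B [] ↔ [] ∈ A.lang ∧ B.start = p := by
  rw [mem_suffixStates]
  constructor
  · rintro ⟨u, v, huv, hu, hv⟩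
    obtain ⟨rfl, rfl⟩ := List.append_eq_nil_iff.1 huv
    exact ⟨hu, Option.some.inj hv⟩
  · rintro ⟨h, rfl⟩
    exact ⟨[], [], rfl, h, rfl⟩

theorem mem_suffixStates_concat {A : PDFA α m} {B : PDFA α n} {w : List α} {a : α} {p : Fin n} :
    p ∈ suffixStates A B (w ++ [a]) ↔
      (∃ p₀ ∈ suffixStates A B w, B.step p₀ a = some p) ∨
        (w ++ [a] ∈ A.lang ∧ B.start = p) := by
  constructor
  · intro h
    obtain ⟨u, v, huv, hu, hv⟩ := mem_suffixStates.1 h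
    rcases List.eq_nil_or_concat v with rfl | ⟨v, b, rfl⟩
    · rw [List.append_nil] at huv
      subst huv
      exact Or.inr ⟨hu, Option.some.inj hv⟩
    · rw [List.concat_eq_append, ← List.append_assoc] at huv
      obtain ⟨rfl, hb⟩ := List.append_inj' huv rfl
      obtain rfl : b = a := by simpa using hb
      rw [List.concat_eq_append, evalFrom_concat, Option.bind_eq_some_iff] at hv
      obtain ⟨p₀, hp₀, hp⟩ := hv
      exact Or.inl ⟨p₀, mem_suffixStates.2 ⟨u, v, rfl, hu, hp₀⟩, hp⟩
  · rintro (⟨p₀, hp₀, hp⟩ | ⟨hw, rfl⟩)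
    · obtain ⟨u, v, rfl, hu, hv⟩ := mem_suffixStates.1 hp₀
      exact mem_suffixStates.2 ⟨u, v ++ [a], by simp, hu, by simp [evalFrom_concat, hv, hp]⟩
    · exact mem_suffixStates.2 ⟨w ++ [a], [], by simp, hw, rfl⟩

/-- The pair of states reached by the subset construction for the concatenation. -/
noncomputable def concatState (A : PDFA α m) (B : PDFA α n) (w : List α) :
    Option (Fin m) × Finset (Fin n) :=
  (A.evalFrom A.start w, suffixStates A B w)

theorem concatState_concat_congr {A : PDFA α m} {B : PDFA α n} {w w' : List α} (a : α)
    (h : concatState A B w = concatState A B w') :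
    concatState A B (w ++ [a]) = concatState A B (w' ++ [a]) := by
  obtain ⟨h₁, h₂⟩ := Prod.mk.inj h
  have h₃ : A.evalFrom A.start (w ++ [a]) = A.evalFrom A.start (w' ++ [a]) := by
    rw [evalFrom_concat, evalFrom_concat, h₁]
  refine Prod.ext h₃ ?_
  ext p
  simp only [concatState, mem_suffixStates_concat, mem_lang, h₂, h₃]

theorem concatState_concat_eq_sink {A : PDFA α m} {B : PDFA α n} {w : List α} (a : α)
    (h : concatState A B w = (none, ∅)) : concatState A B (w ++ [a]) = (none, ∅) := by
  obtain ⟨h₁, h₂⟩ := Prod.mk.inj h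
  have h₃ : A.evalFrom A.start (w ++ [a]) = none := by simp [evalFrom_concat, h₁]
  refine Prod.ext h₃ (Finset.eq_empty_of_forall_notMem fun p hp => ?_)
  simp only [concatState, mem_suffixStates_concat, mem_lang, h₂, h₃] at hp
  simp at hp

theorem mem_mul_lang_iff (A : PDFA α m) (B : PDFA α n) (w : List α) :
    w ∈ A.lang * B.lang ↔ ∃ p ∈ B.accept, p ∈ (concatState A B w).2 := by
  simp only [Language.mem_mul, concatState, mem_suffixStates, mem_lang]
  constructor
  · rintro ⟨u, hu, v, ⟨p, hp, hv⟩, rfl⟩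
    exact ⟨p, hp, u, v, rfl, hu, hv⟩
  · rintro ⟨p, hp, u, v, rfl, hu, hv⟩
    exact ⟨u, hu, v, ⟨p, hp, hv⟩, rfl⟩

theorem start_mem_suffixStates_iff {A : PDFA α m} {B : PDFA α n}
    (hB : ∀ w, B.evalFrom B.start w = some B.start → w = []) (w : List α) :
    B.start ∈ suffixStates A B w ↔ w ∈ A.lang := by
  rw [mem_suffixStates]
  constructor
  · rintro ⟨u, v, rfl, hu, hv⟩
    simpa [hB v hv] using hu
  · intro h
    exact ⟨w, [], by simp, h, rfl⟩

theorem erase_suffixStates_concat_card_le {A : PDFA α m} {B : PDFA α n} (w : List α) (a : α) :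
    ((suffixStates A B (w ++ [a])).erase B.start).card ≤ (suffixStates A B w).card := by
  calc ((suffixStates A B (w ++ [a])).erase B.start).card
      ≤ ((suffixStates A B w).image fun p => (B.step p a).getD B.start).card := by
        refine Finset.card_le_card fun p hp => ?_
        obtain ⟨hne, hp⟩ := Finset.mem_erase.1 hp
        rcases mem_suffixStates_concat.1 hp with ⟨p₀, hp₀, h⟩ | ⟨_, h⟩
        · exact Finset.mem_image.2 ⟨p₀, hp₀, by simp [h]⟩
        · exact absurd h.symm hne
    _ ≤ _ := Finset.card_image_le

theorem fBelow_eq_card_filter (M : PDFA α n) (i : ℕ) :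
    M.fBelow i = (M.accept.filter fun p : Fin n => (p : ℕ) < i).card := by
  rw [← Finset.card_image_of_injective _ Fin.val_injective, fBelow]
  congr 1
  ext j
  simp only [Finset.bind_def, Finset.pure_def, Finset.mem_filter, Finset.mem_sup,
    Finset.mem_singleton, Finset.mem_image]
  grind

theorem fBelow_succ (M : PDFA α n) (q : Fin n) :
    M.fBelow (q + 1) = M.fBelow q + if q ∈ M.accept then 1 else 0 := by
  have h : (M.accept.filter fun p : Fin n => (p : ℕ) < q + 1) =
      (M.accept.filter fun p : Fin n => (p : ℕ) < q) ∪
        M.accept.filter fun p : Fin n => p = q := by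
    ext p
    simp only [Finset.mem_union, Finset.mem_filter, Fin.ext_iff]
    grind
  rw [fBelow_eq_card_filter, h, Finset.card_union_of_disjoint, fBelow_eq_card_filter, Finset.filter_eq']
  · split_ifs <;> simp
  · rw [Finset.disjoint_filter]
    rintro p - hp rfl
    exact lt_irrefl _ hp

theorem fBelow_mono (M : PDFA α n) {i j : ℕ} (h : i ≤ j) : M.fBelow i ≤ M.fBelow j := by
  rw [fBelow_eq_card_filter, fBelow_eq_card_filter]
  refine Finset.card_le_card fun p hp => ?_
  simp only [Finset.mem_filter] at hp ⊢
  exact ⟨hp.1, hp.2.trans_le h⟩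

theorem fBelow_le_fTot (M : PDFA α n) (i : ℕ) : M.fBelow i ≤ M.fTot := by
  rw [fBelow_eq_card_filter]
  exact Finset.card_filter_le _ _

theorem suffixStates_card_le {A : PDFA α m} {B : PDFA α n}
    (hB : ∀ w, B.evalFrom B.start w = some B.start → w = []) {w : List α} {q : Fin m}
    (hw : A.evalFrom A.start w = some q)
    (h : ((suffixStates A B w).erase B.start).card ≤ A.fBelow q) :
    (suffixStates A B w).card ≤ A.fBelow (q + 1) := by
  have hstart : B.start ∈ suffixStates A B w ↔ q ∈ A.accept := by
    rw [start_mem_suffixStates_iff hB, mem_lang, hw]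
    simp
  rw [fBelow_succ]
  split_ifs with hq
  · have := Finset.card_erase_add_one (hstart.2 hq)
    omega
  · rwa [Finset.erase_eq_of_notMem (mt hstart.1 hq)] at h

/-- Every run over `A` visits each final state at most once, which bounds the number of runs of
`B` started before the current position. -/
theorem erase_suffixStates_card_le {A : PDFA α m} {B : PDFA α n} (hA : A.Ordered)
    (hB : ∀ w, B.evalFrom B.start w = some B.start → w = []) (w : List α) :
    (∀ q, A.evalFrom A.start w = some q →
      ((suffixStates A B w).erase B.start).card ≤ A.fBelow q) ∧
    (A.evalFrom A.start w = none → ((suffixStates A B w).erase B.start).card ≤ A.fTot) := by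
  induction w using List.reverseRecOn with
  | nil =>
    have h : (suffixStates A B ([] : List α)).erase B.start = ∅ :=
      Finset.eq_empty_of_forall_notMem fun p hp =>
        (Finset.mem_erase.1 hp).1 (mem_suffixStates_nil.1 (Finset.mem_erase.1 hp).2).2.symm
    simp [h]
  | append_singleton w a ih =>
    have hcard := erase_suffixStates_concat_card_le (A := A) (B := B) w a
    cases hw : A.evalFrom A.start w with
    | none =>
      have hnone : A.evalFrom A.start (w ++ [a]) = none := by simp [evalFrom_concat, hw]
      have hstart : B.start ∉ suffixStates A B w := by
        rw [start_mem_suffixStates_iff hB, mem_lang, hw]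
        simp
      have := ih.2 hw
      rw [Finset.erase_eq_of_notMem hstart] at this
      simp only [hnone]
      exact ⟨by simp, fun _ => hcard.trans this⟩
    | some p =>
      have hp := suffixStates_card_le hB hw (ih.1 p hw)
      refine ⟨fun q hq => ?_, fun _ => (hcard.trans hp).trans (fBelow_le_fTot _ _)⟩
      have hlt : p < q := hA.2 p a q (by simpa [evalFrom_concat, hw] using hq)
      exact (hcard.trans hp).trans (fBelow_mono _ hlt)

/-- In an ordered partial DFA at most `k ^ q` words lead to the state `q`. -/
theorem Ordered.card_le_pow [Fintype α] {M : PDFA α n} (hM : M.Ordered) (q : Fin n)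
    (W : Finset (List α)) (hW : ∀ w ∈ W, M.evalFrom M.start w = some q) :
    W.card ≤ Fintype.card α ^ (q : ℕ) := by
  rcases isEmpty_or_nonempty α with hα | ⟨⟨c⟩⟩
  · rcases W.eq_empty_or_nonempty with rfl | ⟨w, hw⟩
    · simp
    · have h := hW w hw
      rw [Subsingleton.elim w [], evalFrom, Option.some.injEq] at h
      rw [← h, hM.1, pow_zero]
      exact Finset.card_le_one_of_subsingleton W
  · have hlen (w : List α) (hw : w ∈ W) : w.length ≤ q := by
      have := hM.add_length_le (hW w hw)
      omega
    have key (u v : List α) (hu : u ∈ W) (hv : v ∈ W) (hle : u.length ≤ v.length)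
        (huv : (fun j : Fin q => u.getD j c) = fun j : Fin q => v.getD j c) : u = v := by
      have htake : u = v.take u.length := by
        refine List.ext_getElem (by simp [hle]) fun j h₁ h₂ => ?_
        have h₃ := congrFun huv ⟨j, h₁.trans_le (hlen u hu)⟩
        simpa [List.getD_eq_getElem, h₁, h₁.trans_le hle] using h₃
      have hsplit : v = u ++ v.drop u.length := by
        conv_lhs => rw [← List.take_append_drop u.length v, ← htake]
      have heval := hW v hv
      rw [hsplit, evalFrom_append, hW u hu] at heval
      have h := hM.add_length_le (q := q) (p := q) heval
      have hnil : v.drop u.length = [] := List.length_eq_zero_iff.1 (by omega)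
      rw [hsplit, hnil, List.append_nil]
    calc W.card ≤ (Finset.univ : Finset (Fin q → α)).card := by
          refine Finset.card_le_card_of_injOn (fun w j => w.getD j c) (by simp) ?_
          intro u hu v hv huv
          rcases le_total u.length v.length with h | h
          · exact key u v hu hv h huv
          · exact (key v u hv hu h huv.symm).symm
      _ = _ := by simp

end PDFA

theorem Finset.card_filter_powerset_card_le {β : Type*} (S : Finset β) (t : ℕ) :
    (S.powerset.filter fun P => P.card ≤ t).card = ∑ j ∈ Finset.range (t + 1), S.card.choose j := by
  rw [Finset.card_eq_sum_card_fiberwise (f := Finset.card) (t := Finset.range (t + 1))]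
  · refine Finset.sum_congr rfl fun j hj => ?_
    rw [← Finset.card_powersetCard]
    congr 1
    ext P
    simp only [Finset.mem_filter, Finset.mem_powerset, Finset.mem_powersetCard,
      Finset.mem_range] at hj ⊢
    grind
  · intro P hP
    simp only [Finset.coe_filter, Set.mem_ofPred_eq] at hP
    simp only [Finset.coe_range, Set.mem_Iio]
    omega

namespace PDFA

variable {α : Type} {m n : ℕ}

theorem card_concatState_fiber_le_pow [Fintype α] {A : PDFA α m} (B : PDFA α n)
    (hA : A.Ordered) (q : Fin m) (T : Finset (Option (Fin m) × Finset (Fin n)))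
    (hT : ∀ x ∈ T, ∃ w, concatState A B w = x) (hq : ∀ x ∈ T, x.1 = some q) :
    T.card ≤ Fintype.card α ^ (q : ℕ) := by
  choose! word h_word using hT
  have hinj : Set.InjOn word T := fun x hx y hy hxy => by
    rw [← h_word x hx, hxy, h_word y hy]
  rw [← Finset.card_image_of_injOn hinj]
  refine hA.card_le_pow q _ fun w hw => ?_
  obtain ⟨x, hx, rfl⟩ := Finset.mem_image.1 hw
  have h := hq x hx
  rwa [← h_word x hx] at h

/-- Pairs with a fixed first component, whose second components agree on containing `s`, are
counted by the subsets avoiding `s`. -/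
theorem card_le_sum_choose_of_erase_card_le {β : Type*} (T : Finset (β × Finset (Fin n))) (o : β)
    (s : Fin n) (c : Prop) (t : ℕ) (ho : ∀ x ∈ T, x.1 = o) (hs : ∀ x ∈ T, s ∈ x.2 ↔ c)
    (ht : ∀ x ∈ T, (x.2.erase s).card ≤ t) :
    T.card ≤ ∑ j ∈ Finset.range (t + 1), (n - 1).choose j := by
  have hcard : ((Finset.univ : Finset (Fin n)).erase s).card = n - 1 := by simp
  rw [← hcard, ← Finset.card_filter_powerset_card_le]
  refine Finset.card_le_card_of_injOn (fun x => x.2.erase s) (fun x hx => ?_) ?_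
  · simpa using ⟨Finset.erase_subset_erase _ (Finset.subset_univ _), ht x hx⟩
  · intro x hx y hy hxy
    refine Prod.ext ((ho x hx).trans (ho y hy).symm) ?_
    have hiff := (hs x hx).trans (hs y hy).symm
    ext p
    by_cases hp : p = s
    · rw [hp, hiff]
    · have h := Finset.ext_iff.1 hxy p
      simpa [hp] using h

end PDFA

/-- State upper bound for the concatenation of two finite languages
given by partial DFAs `A` (with `m` states, topologically numbered) and `B`
(with `n` states). -/
theorem concat_isc_upper {α : Type} [Fintype α] {m n : ℕ}
    (A : PDFA α m) (B : PDFA α n)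
    (hfA : Set.Finite {w : List α | w ∈ A.lang}) (hfB : Set.Finite {w : List α | w ∈ B.lang})
    (hord : A.Ordered) :
    ∃ N : ℕ,
      N ≤ (∑ i ∈ Finset.range m,
              min ((Fintype.card α) ^ i)
                (∑ j ∈ Finset.range (A.fBelow i + 1), (n - 1).choose j))
          + ∑ j ∈ Finset.range (A.fTot + 1), (n - 1).choose j - 1 ∧
      ∃ C : PDFA α N, C.lang = A.lang * B.lang := by
  have hpos (t : ℕ) : 1 ≤ ∑ j ∈ Finset.range (t + 1), (n - 1).choose j := by
    rw [Finset.sum_range_succ']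
    simp
  by_cases hne : ∃ u, u ∈ B.lang
  · obtain ⟨u, hu⟩ := hne
    have hB : ∀ w, B.evalFrom B.start w = some B.start → w = [] :=
      fun _ => PDFA.eq_nil_of_evalFrom_start hfB hu
    set T : Finset (Option (Fin m) × Finset (Fin n)) :=
      Finset.univ.filter fun x => x ≠ (none, ∅) ∧ ∃ w, PDFA.concatState A B w = x with hTdef
    have hT (x) : x ∈ T ↔ x ≠ (none, ∅) ∧ ∃ w, PDFA.concatState A B w = x := by simp [hTdef]
    refine ⟨T.card, ?_, PDFA.exists_lang_eq_of_rightInvariant _ (PDFA.concatState A B) (none, ∅)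
      (fun x => ∃ p ∈ B.accept, p ∈ x.2) T hT ?_ (fun _ _ a h => PDFA.concatState_concat_congr a h)
      (fun _ a h => PDFA.concatState_concat_eq_sink a h) (PDFA.mem_mul_lang_iff A B) (by simp)⟩
    · have hreach (o : Option (Fin m)) :
          ∀ x ∈ T.filter (fun x => x.1 = o), ∃ w, PDFA.concatState A B w = x :=
        fun x hx => ((hT x).1 (Finset.mem_filter.1 hx).1).2
      have hfst (o : Option (Fin m)) : ∀ x ∈ T.filter (fun x => x.1 = o), x.1 = o :=
        fun x hx => (Finset.mem_filter.1 hx).2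
      have hsome (q : Fin m) : (T.filter fun x => x.1 = some q).card ≤
          min (Fintype.card α ^ (q : ℕ))
            (∑ j ∈ Finset.range (A.fBelow q + 1), (n - 1).choose j) := by
        refine le_min (PDFA.card_concatState_fiber_le_pow B hord q _ (hreach _) (hfst _))
          (PDFA.card_le_sum_choose_of_erase_card_le _ (some q) B.start (q ∈ A.accept) _ (hfst _)
            (fun x hx => ?_) fun x hx => ?_)
        all_goals
          obtain ⟨w, rfl⟩ := hreach _ x hx
          have hw : A.evalFrom A.start w = some q := hfst _ _ hx
        · exact (PDFA.start_mem_suffixStates_iff hB w).trans (by simp [PDFA.mem_lang, hw])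
        · exact (PDFA.erase_suffixStates_card_le hord hB w).1 q hw
      have hnone : (T.filter fun x => x.1 = none).card + 1 ≤
          ∑ j ∈ Finset.range (A.fTot + 1), (n - 1).choose j := by
        rw [← Finset.card_insert_of_notMem (a := (none, ∅)) (by simp [hTdef])]
        refine PDFA.card_le_sum_choose_of_erase_card_le _ none B.start False _
          (fun x hx => ?_) (fun x hx => ?_) fun x hx => ?_
        all_goals
          obtain rfl | hx := Finset.mem_insert.1 hx
          · simp
          obtain ⟨w, rfl⟩ := hreach _ x hx
          have hw : A.evalFrom A.start w = none := hfst _ _ hx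
        · exact hw
        · exact (PDFA.start_mem_suffixStates_iff hB w).trans (by simp [PDFA.mem_lang, hw])
        · exact (PDFA.erase_suffixStates_card_le hord hB w).2 hw
      rw [Finset.card_eq_sum_card_fiberwise (f := Prod.fst) (t := Finset.univ) (by simp),
        Fintype.sum_option, ← Fin.sum_univ_eq_sum_range
          (fun i => min (Fintype.card α ^ i)
            (∑ j ∈ Finset.range (A.fBelow i + 1), (n - 1).choose j))]
      have := Finset.sum_le_sum fun q (_ : q ∈ Finset.univ) => hsome q
      omega
    · simp [PDFA.concatState, PDFA.evalFrom]
  · refine ⟨1, ?_, ⟨fun _ _ => none, 0, ∅⟩, ?_⟩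
    · have hm : 0 < m := A.start.pos
      have hterm : 1 ≤ ∑ i ∈ Finset.range m, min (Fintype.card α ^ i)
          (∑ j ∈ Finset.range (A.fBelow i + 1), (n - 1).choose j) :=
        (le_min (pow_zero _).ge (hpos _)).trans
          (Finset.single_le_sum
            (f := fun i => min (Fintype.card α ^ i)
              (∑ j ∈ Finset.range (A.fBelow i + 1), (n - 1).choose j)) (fun _ _ => Nat.zero_le _) (Finset.mem_range.2 hm))
      have := hpos A.fTot
      omega
    · ext w
      simp only [PDFA.mem_lang, Language.mem_mul]
      constructor
      · simp
      · rintro ⟨_, _, v, hv, _⟩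
        exact absurd ⟨v, hv⟩ hne
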